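/- Let Δ be an n-dimensional simplex in ℝ^n and let 2 ≤ r ≤ n. Then for all convex bodies K_1,…,K_r in ℝ^n: V(K_1,…,K_r,Δ[n−r])·V_n(Δ)^{r−1} ≤ ∏_{i=1}^r V(K_i,Δ[n−1]). -/

import Mathlib

open Pointwise MeasureTheory

/-- The mixed volume of an `n`-tuple of sets in `ℝⁿ`, via the polarization formula. -/
noncomputable def mixedVol (n : ℕ) (K : Fin n → Set (EuclideanSpace ℝ (Fin n))) : ℝ :=
  ((n.factorial : ℝ))⁻¹ *
    ∑ S : Finset (Fin n), (-1 : ℝ) ^ (n - S.card) * (volume (∑ i ∈ S, K i)).toReal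

/-- A convex body: a nonempty compact convex set. -/
def IsConvexBody {n : ℕ} (K : Set (EuclideanSpace ℝ (Fin n))) : Prop :=
  Convex ℝ K ∧ IsCompact K ∧ K.Nonempty

/-- The polarized determinant, `n!` times the mixed discriminant. -/
noncomputable def mixedDet {n : ℕ} (A : Fin n → Matrix (Fin n) (Fin n) ℝ) : ℝ :=
  ∑ σ : Equiv.Perm (Fin n), (Matrix.of fun j => A (σ j) j).det

lemma det_sum_eq_sum_piFinset {n : ℕ} (A : Fin n → Matrix (Fin n) (Fin n) ℝ)
    (S : Finset (Fin n)) :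
    (∑ i ∈ S, A i).det =
      ∑ g ∈ Fintype.piFinset (fun _ : Fin n => S), (Matrix.of fun j => A (g j) j).det := by
  have := (Matrix.detRowAlternating (n := Fin n) (R := ℝ)).toMultilinearMap.map_sum_finset
    (fun j i => A i j) (fun _ => S)
  have h : (∑ i ∈ S, A i) = Matrix.of fun j => ∑ i ∈ S, A i j := by
    ext i j
    simp [Matrix.sum_apply, Finset.sum_apply]
  rw [h]
  exact this

lemma sum_neg_one_pow_of_subset {n : ℕ} (U : Finset (Fin n)) :
    (∑ S : Finset (Fin n), if U ⊆ S then (-1 : ℝ) ^ (n - S.card) else 0) =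
      if U = Finset.univ then 1 else 0 := by
  have h := Finset.sum_powerset_neg_one_pow_card (x := Uᶜ)
  rw [← Finset.sum_filter]
  have h2 : (∑ S : Finset (Fin n) with U ⊆ S, (-1 : ℝ) ^ (n - S.card)) =
      ∑ T ∈ Uᶜ.powerset, (-1 : ℝ) ^ T.card := by
    refine Finset.sum_nbij' (fun S => Sᶜ) (fun S => Sᶜ) ?_ ?_ ?_ ?_ ?_
    · intro S hS
      simpa using hS
    · intro S hS
      have := Finset.mem_powerset.1 hS
      simpa using Finset.subset_compl_comm.1 this
    · intro S _; simp
    · intro S _; simp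
    · intro S _; simp [Finset.card_compl]
  rw [h2]
  have h3 : (∑ T ∈ Uᶜ.powerset, (-1 : ℝ) ^ T.card) =
      ((∑ T ∈ Uᶜ.powerset, (-1 : ℤ) ^ T.card : ℤ) : ℝ) := by push_cast; rfl
  rw [h3, h]
  simp

lemma sum_neg_one_pow_mul_det {n : ℕ} (A : Fin n → Matrix (Fin n) (Fin n) ℝ) :
    ∑ S : Finset (Fin n), (-1 : ℝ) ^ (n - S.card) * (∑ i ∈ S, A i).det = mixedDet A := by
  have h1 : ∀ S : Finset (Fin n), (-1 : ℝ) ^ (n - S.card) * (∑ i ∈ S, A i).det =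
      ∑ g : Fin n → Fin n, (if Finset.univ.image g ⊆ S then (-1 : ℝ) ^ (n - S.card) else 0) *
        (Matrix.of fun j => A (g j) j).det := by
    intro S
    rw [det_sum_eq_sum_piFinset, Finset.mul_sum]
    simp_rw [ite_mul, zero_mul]
    rw [← Finset.sum_filter]
    refine Finset.sum_congr ?_ fun _ _ => rfl
    ext g
    simp [Fintype.mem_piFinset, Finset.image_subset_iff]
  simp_rw [h1]
  rw [Finset.sum_comm]
  simp_rw [← Finset.sum_mul, sum_neg_one_pow_of_subset, ite_mul, zero_mul, one_mul]
  rw [← Finset.sum_filter, mixedDet]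
  symm
  refine Finset.sum_bij (fun σ _ => (σ : Fin n → Fin n)) ?_ ?_ ?_ ?_
  · intro σ _
    simp [Finset.image_univ_equiv]
  · intro σ _ τ _ h
    exact Equiv.coe_fn_injective h
  · intro g hg
    have hs : Function.Surjective g := by
      intro y
      have : y ∈ Finset.univ.image g := by
        rw [(Finset.mem_filter.1 hg).2]; exact Finset.mem_univ y
      simpa using this
    exact ⟨Equiv.ofBijective g (Finite.surjective_iff_bijective.1 hs), Finset.mem_univ _, rfl⟩
  · intro σ _
    rfl

lemma mixedDet_smul {n : ℕ} (c : Fin n → ℝ) (A : Fin n → Matrix (Fin n) (Fin n) ℝ) :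
    mixedDet (fun i => c i • A i) = (∏ i, c i) * mixedDet A := by
  simp only [mixedDet, Finset.mul_sum]
  refine Finset.sum_congr rfl fun σ _ => ?_
  rw [← Equiv.prod_comp σ c, ← Matrix.det_mul_column]
  rfl

lemma mixedDet_nonneg {n : ℕ} {κ : Type*} (B : Finset κ) (p : Fin n → κ → ℝ)
    (v : Fin n → κ → Fin n → ℝ) (hp : ∀ i, ∀ k ∈ B, 0 ≤ p i k) :
    0 ≤ mixedDet (fun i => ∑ k ∈ B, p i k • Matrix.vecMulVec (v i k) (v i k)) := by
  classical
  have h1 : ∀ σ : Equiv.Perm (Fin n),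
      (Matrix.of fun j => (∑ k ∈ B, p (σ j) k • Matrix.vecMulVec (v (σ j) k) (v (σ j) k)) j).det =
      ∑ h ∈ Fintype.piFinset (fun _ : Fin n => B),
        (∏ i, p i (h i)) * ((Equiv.Perm.sign σ : ℝ) * ∏ j, v (σ j) (h (σ j)) j) *
          (Matrix.of fun i => v i (h i)).det := by
    intro σ
    have e := (Matrix.detRowAlternating (n := Fin n) (R := ℝ)).toMultilinearMap.map_sum_finset
      (fun j k => (p (σ j) k * v (σ j) k j) • v (σ j) k) (fun _ => B)
    have h : (Matrix.of fun j =>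
        (∑ k ∈ B, p (σ j) k • Matrix.vecMulVec (v (σ j) k) (v (σ j) k)) j) =
        fun j => ∑ k ∈ B, (p (σ j) k * v (σ j) k j) • v (σ j) k := by
      ext i j
      simp [Matrix.sum_apply, Finset.sum_apply, Matrix.vecMulVec_apply, mul_assoc]
    rw [h]
    refine e.trans ?_
    refine Finset.sum_nbij' (fun h i => h (σ.symm i)) (fun h i => h (σ i)) ?_ ?_ ?_ ?_ ?_
    · intro h hh
      simp only [Fintype.mem_piFinset] at hh ⊢
      exact fun i => hh _
    · intro h hh
      simp only [Fintype.mem_piFinset] at hh ⊢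
      exact fun i => hh _
    · intro h _; simp
    · intro h _; simp
    · intro h _
      have e1 := (Matrix.detRowAlternating (n := Fin n) (R := ℝ)).toMultilinearMap.map_smul_univ
        (fun j => p (σ j) (h j) * v (σ j) (h j) j) (fun j => v (σ j) (h j))
      refine e1.trans ?_
      have e2 : (Matrix.detRowAlternating (n := Fin n) (R := ℝ)).toMultilinearMap
          (fun j => v (σ j) (h j)) = (Equiv.Perm.sign σ : ℝ) *
          (Matrix.of fun i => v i (h (σ.symm i))).det := by
        have := Matrix.det_permute σ (Matrix.of fun i => v i (h (σ.symm i)))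
        rw [← this]
        change Matrix.det _ = _
        congr 1
        ext i j
        simp
      rw [e2, Finset.prod_mul_distrib]
      have e3 : ∏ j, p (σ j) (h j) = ∏ i, p i (h (σ.symm i)) := by
        rw [← Equiv.prod_comp σ (fun i => p i (h (σ.symm i)))]; simp
      rw [e3]
      simp only [smul_eq_mul, Equiv.symm_apply_apply]
      ring
  rw [mixedDet]
  simp_rw [h1]
  rw [Finset.sum_comm]
  refine Finset.sum_nonneg fun h hh => ?_
  rw [← Finset.sum_mul, ← Finset.mul_sum]
  have e4 : ∑ σ : Equiv.Perm (Fin n), (Equiv.Perm.sign σ : ℝ) * ∏ j, v (σ j) (h (σ j)) j =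
      (Matrix.of fun i => v i (h i)).det := by
    rw [Matrix.det_apply']
    rfl
  rw [e4, mul_assoc]
  refine mul_nonneg (Finset.prod_nonneg fun i _ => hp i _ ?_) (mul_self_nonneg _)
  exact Fintype.mem_piFinset.1 hh i

lemma sum_neg_one_pow_mul_sum_pow {n : ℕ} (c : Fin n → ℝ) :
    ∑ S : Finset (Fin n), (-1 : ℝ) ^ (n - S.card) * (∑ i ∈ S, c i) ^ n =
      n.factorial * ∏ i, c i := by
  have h := sum_neg_one_pow_mul_det (fun i => c i • (1 : Matrix (Fin n) (Fin n) ℝ))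
  rw [mixedDet_smul] at h
  have h1 : mixedDet (fun _ : Fin n => (1 : Matrix (Fin n) (Fin n) ℝ)) = n.factorial := by
    have : ∀ σ : Equiv.Perm (Fin n),
      (Matrix.of fun j : Fin n => (1 : Matrix (Fin n) (Fin n) ℝ) j).det = 1 :=
      fun _ => Matrix.det_one
    simp only [mixedDet]
    rw [Finset.sum_congr rfl fun σ _ => this σ]
    simp [Fintype.card_perm]
  rw [h1, mul_comm] at h
  rw [← h]
  refine Finset.sum_congr rfl fun S _ => ?_
  rw [← Finset.sum_smul, Matrix.det_smul]
  simp

section ExponentialFamily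

variable {n : ℕ} (A : Finset (EuclideanSpace ℝ (Fin n))) (w : EuclideanSpace ℝ (Fin n) → ℝ)

/-- The Laplace transform of the discrete measure with weights `w` on `A`. -/
noncomputable def laplaceSum (x : EuclideanSpace ℝ (Fin n)) : ℝ :=
  ∑ a ∈ A, w a * Real.exp (inner ℝ a x)

/-- The probability weight of `a` under the exponential tilt by `x`. -/
noncomputable def tiltWeight (x a : EuclideanSpace ℝ (Fin n)) : ℝ :=
  w a * Real.exp (inner ℝ a x) / laplaceSum A w x

/-- The mean of the tilted measure, which is the gradient of `log (laplaceSum A w)`. -/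
noncomputable def tiltMean (x : EuclideanSpace ℝ (Fin n)) : EuclideanSpace ℝ (Fin n) :=
  ∑ a ∈ A, tiltWeight A w x a • a

/-- The covariance operator of the tilted measure. -/
noncomputable def tiltCov (x : EuclideanSpace ℝ (Fin n)) :
    EuclideanSpace ℝ (Fin n) →L[ℝ] EuclideanSpace ℝ (Fin n) :=
  ∑ a ∈ A, tiltWeight A w x a •
    (innerSL ℝ (a - tiltMean A w x)).smulRight (a - tiltMean A w x)

/-- The covariance matrix of the tilted measure. -/
noncomputable def tiltCovMatrix (x : EuclideanSpace ℝ (Fin n)) : Matrix (Fin n) (Fin n) ℝ :=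
  ∑ a ∈ A, tiltWeight A w x a •
    Matrix.vecMulVec (fun j => (a - tiltMean A w x) j) (fun j => (a - tiltMean A w x) j)

/-- Nonnegative weights on `A` that do not all vanish. -/
def IsWeight : Prop := (∀ a ∈ A, 0 ≤ w a) ∧ ∃ a ∈ A, 0 < w a

variable {A w}

lemma laplaceSum_pos (hw : IsWeight A w) (x : EuclideanSpace ℝ (Fin n)) :
    0 < laplaceSum A w x := by
  obtain ⟨a, ha, hpos⟩ := hw.2
  exact Finset.sum_pos' (fun b hb => mul_nonneg (hw.1 b hb) (Real.exp_pos _).le)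
    ⟨a, ha, mul_pos hpos (Real.exp_pos _)⟩

lemma tiltWeight_nonneg (hw : IsWeight A w) (x : EuclideanSpace ℝ (Fin n)) :
    ∀ a ∈ A, 0 ≤ tiltWeight A w x a := fun a ha =>
  div_nonneg (mul_nonneg (hw.1 a ha) (Real.exp_pos _).le) (laplaceSum_pos hw x).le

lemma tiltWeight_pos (hw : IsWeight A w) (x : EuclideanSpace ℝ (Fin n))
    {a : EuclideanSpace ℝ (Fin n)} (ha : 0 < w a) : 0 < tiltWeight A w x a :=
  div_pos (mul_pos ha (Real.exp_pos _)) (laplaceSum_pos hw x)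

lemma sum_tiltWeight (hw : IsWeight A w) (x : EuclideanSpace ℝ (Fin n)) :
    ∑ a ∈ A, tiltWeight A w x a = 1 := by
  simp only [tiltWeight]
  rw [← Finset.sum_div]
  exact div_self (laplaceSum_pos hw x).ne'

lemma tiltCov_apply (x u : EuclideanSpace ℝ (Fin n)) :
    tiltCov A w x u = ∑ a ∈ A, tiltWeight A w x a •
      (inner ℝ (a - tiltMean A w x) u • (a - tiltMean A w x)) := by
  simp only [tiltCov, sum_apply, smul_apply, ContinuousLinearMap.smulRight_apply,
    innerSL_apply_apply]

lemma tiltCov_apply_eq_sub (hw : IsWeight A w) (x u : EuclideanSpace ℝ (Fin n)) :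
    tiltCov A w x u = (∑ a ∈ A, (tiltWeight A w x a * inner ℝ a u) • a) -
      inner ℝ (tiltMean A w x) u • tiltMean A w x := by
  rw [tiltCov_apply]
  have h1 : ∑ a ∈ A, tiltWeight A w x a * inner ℝ a u = inner ℝ (tiltMean A w x) u := by
    simp only [tiltMean, sum_inner, real_inner_smul_left]
  have h2 := sum_tiltWeight hw x
  have h3 : ∀ a ∈ A, tiltWeight A w x a •
      (inner ℝ (a - tiltMean A w x) u • (a - tiltMean A w x)) =
      (tiltWeight A w x a * inner ℝ a u) • a
      - inner ℝ (tiltMean A w x) u • (tiltWeight A w x a • a)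
      - (tiltWeight A w x a * inner ℝ a u) • tiltMean A w x
      + tiltWeight A w x a • (inner ℝ (tiltMean A w x) u • tiltMean A w x) := by
    intro a _
    rw [inner_sub_left]
    module
  rw [Finset.sum_congr rfl h3, Finset.sum_add_distrib, Finset.sum_sub_distrib,
    Finset.sum_sub_distrib, ← Finset.smul_sum, ← Finset.sum_smul, ← Finset.sum_smul, h1, h2]
  change _ - inner ℝ (tiltMean A w x) u • tiltMean A w x - _ + _ = _
  module

lemma hasFDerivAt_exp_inner (a x : EuclideanSpace ℝ (Fin n)) :
    HasFDerivAt (fun y => w a * Real.exp (inner ℝ a y))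
      ((w a * Real.exp (inner ℝ a x)) • innerSL ℝ a) x := by
  have := ((innerSL ℝ a).hasFDerivAt (x := x)).exp.const_mul (w a)
  simpa [smul_smul] using this

lemma hasFDerivAt_laplaceSum (x : EuclideanSpace ℝ (Fin n)) :
    HasFDerivAt (laplaceSum A w)
      (∑ a ∈ A, (w a * Real.exp (inner ℝ a x)) • innerSL ℝ a) x :=
  HasFDerivAt.fun_sum fun a _ => hasFDerivAt_exp_inner a x

lemma hasFDerivAt_log_laplaceSum (hw : IsWeight A w) (x : EuclideanSpace ℝ (Fin n)) :
    HasFDerivAt (fun y => Real.log (laplaceSum A w y)) (innerSL ℝ (tiltMean A w x)) x := by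
  have := (hasFDerivAt_laplaceSum (A := A) (w := w) x).log (laplaceSum_pos hw x).ne'
  refine this.congr_fderiv ?_
  ext1 u
  simp only [tiltMean, tiltWeight, innerSL_apply_apply, sum_inner, real_inner_smul_left,
    smul_apply, sum_apply, smul_eq_mul, Finset.mul_sum]
  exact Finset.sum_congr rfl fun a _ => by ring

lemma hasFDerivAt_tiltMean (hw : IsWeight A w) (x : EuclideanSpace ℝ (Fin n)) :
    HasFDerivAt (tiltMean A w) (tiltCov A w x) x := by
  have hZ := (laplaceSum_pos hw x).ne'
  have hI := (hasDerivAt_inv hZ).comp_hasFDerivAt x (hasFDerivAt_laplaceSum (A := A) (w := w) x)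
  have h1 : HasFDerivAt (tiltMean A w) _ x := HasFDerivAt.fun_sum (u := A) fun a _ =>
    ((hasFDerivAt_exp_inner (w := w) a x).mul hI).smul_const a
  refine h1.congr_fderiv ?_
  ext1 u
  rw [tiltCov_apply_eq_sub hw]
  have h2 : inner ℝ (tiltMean A w x) u • tiltMean A w x =
    ∑ a ∈ A, (tiltWeight A w x a * inner ℝ (tiltMean A w x) u) • a := by
    conv_lhs => rw [tiltMean]
    rw [Finset.smul_sum]
    refine Finset.sum_congr rfl fun a _ => ?_
    rw [smul_smul, mul_comm]
    rfl
  have h3 : inner ℝ (tiltMean A w x) u =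
      (laplaceSum A w x)⁻¹ * ∑ b ∈ A, (w b * Real.exp (inner ℝ b x)) * inner ℝ b u := by
    simp only [tiltMean, tiltWeight, sum_inner, real_inner_smul_left, Finset.mul_sum]
    exact Finset.sum_congr rfl fun a _ => by ring
  rw [h2, ← Finset.sum_sub_distrib, sum_apply]
  refine Finset.sum_congr rfl fun a _ => ?_
  rw [← sub_smul, h3]
  simp only [tiltWeight, ContinuousLinearMap.smulRight_apply, add_apply,
    smul_apply, innerSL_apply_apply, smul_eq_mul,
    sum_apply, Function.comp_apply]
  congr 1
  field_simp
  ring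

lemma inner_tiltCov_self (x u : EuclideanSpace ℝ (Fin n)) :
    inner ℝ (tiltCov A w x u) u =
      ∑ a ∈ A, tiltWeight A w x a * inner ℝ (a - tiltMean A w x) u ^ 2 := by
  rw [tiltCov_apply, sum_inner]
  refine Finset.sum_congr rfl fun a _ => ?_
  rw [real_inner_smul_left, real_inner_smul_left]
  ring

lemma toMatrix_tiltCov (x : EuclideanSpace ℝ (Fin n)) :
    LinearMap.toMatrix (EuclideanSpace.basisFun (Fin n) ℝ).toBasis
      (EuclideanSpace.basisFun (Fin n) ℝ).toBasis (tiltCov A w x).toLinearMap =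
      tiltCovMatrix A w x := by
  ext i j
  rw [LinearMap.toMatrix_apply]
  simp [tiltCov_apply, tiltCovMatrix, Matrix.sum_apply, Matrix.vecMulVec_apply,
    EuclideanSpace.inner_single_right]
  refine Finset.sum_congr rfl fun a _ => by ring

end ExponentialFamily

section VolumeFormula

variable {n : ℕ} {A : Finset (EuclideanSpace ℝ (Fin n))}

/-- The convex hull of the points of `A` with positive weight. -/
def weightHull (A : Finset (EuclideanSpace ℝ (Fin n))) (w : EuclideanSpace ℝ (Fin n) → ℝ) :
    Set (EuclideanSpace ℝ (Fin n)) :=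
  convexHull ℝ {a | a ∈ A ∧ 0 < w a}

lemma tiltMean_mem_weightHull {w : EuclideanSpace ℝ (Fin n) → ℝ} (hw : IsWeight A w)
    (x : EuclideanSpace ℝ (Fin n)) : tiltMean A w x ∈ weightHull A w := by
  classical
  have hz : ∀ a ∈ A, ¬ 0 < w a → tiltWeight A w x a = 0 := fun a ha h => by
    have : w a = 0 := le_antisymm (not_lt.1 h) (hw.1 a ha)
    simp [tiltWeight, this]
  have h1 : tiltMean A w x = ∑ a ∈ A with 0 < w a, tiltWeight A w x a • a := by
    rw [tiltMean, Finset.sum_filter]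
    refine Finset.sum_congr rfl fun a ha => ?_
    split_ifs with h
    · rfl
    · rw [hz a ha h, zero_smul]
  have h2 : ∑ a ∈ A with 0 < w a, tiltWeight A w x a = 1 := by
    rw [← sum_tiltWeight hw x, Finset.sum_filter]
    refine Finset.sum_congr rfl fun a ha => ?_
    split_ifs with h
    · rfl
    · rw [hz a ha h]
  rw [h1]
  refine (convex_convexHull ℝ _).sum_mem (fun a ha => tiltWeight_nonneg hw x a
    (Finset.mem_filter.1 ha).1) h2 fun a ha => subset_convexHull ℝ _ ?_
  exact Finset.mem_filter.1 ha

lemma inner_le_log_laplaceSum {w : EuclideanSpace ℝ (Fin n) → ℝ} (hw : IsWeight A w)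
    {z : EuclideanSpace ℝ (Fin n)} (hz : z ∈ weightHull A w) (x : EuclideanSpace ℝ (Fin n)) :
    inner ℝ z x ≤ Real.log (laplaceSum A w x) + ∑ a ∈ A, |Real.log (w a)| := by
  set C := Real.log (laplaceSum A w x) + ∑ a ∈ A, |Real.log (w a)| with hC
  have hconv : Convex ℝ {z : EuclideanSpace ℝ (Fin n) | inner ℝ z x ≤ C} := by
    refine convex_halfSpace_le ⟨fun a b => inner_add_left a b x, fun c a => ?_⟩ C
    rw [real_inner_smul_left, smul_eq_mul]
  refine (convexHull_min ?_ hconv) hz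
  rintro a ⟨ha, hpos⟩
  have h1 : w a * Real.exp (inner ℝ a x) ≤ laplaceSum A w x :=
    Finset.single_le_sum (f := fun a => w a * Real.exp (inner ℝ a x))
      (fun b hb => mul_nonneg (hw.1 b hb) (Real.exp_pos _).le) ha
  have h2 := Real.log_le_log (mul_pos hpos (Real.exp_pos _)) h1
  rw [Real.log_mul hpos.ne' (Real.exp_pos _).ne', Real.log_exp] at h2
  have h3 : |Real.log (w a)| ≤ ∑ a ∈ A, |Real.log (w a)| :=
    Finset.single_le_sum (f := fun a => |Real.log (w a)|) (fun b _ => abs_nonneg _) ha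
  have h4 := neg_abs_le (Real.log (w a))
  change inner ℝ a x ≤ C
  linarith

variable {ι : Type*} {S : Finset ι} {w : ι → EuclideanSpace ℝ (Fin n) → ℝ} {c : ι → ℝ}

/-- The gradient of the potential `∑ c i * log (laplaceSum A (w i))`. -/
noncomputable def gradientMap (A : Finset (EuclideanSpace ℝ (Fin n))) (S : Finset ι)
    (w : ι → EuclideanSpace ℝ (Fin n) → ℝ) (c : ι → ℝ) (x : EuclideanSpace ℝ (Fin n)) :
    EuclideanSpace ℝ (Fin n) :=
  ∑ i ∈ S, c i • tiltMean A (w i) x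

lemma hasFDerivAt_gradientMap (hw : ∀ i, IsWeight A (w i)) (x : EuclideanSpace ℝ (Fin n)) :
    HasFDerivAt (gradientMap A S w c) (∑ i ∈ S, c i • tiltCov A (w i) x) x :=
  HasFDerivAt.fun_sum fun i _ => (hasFDerivAt_tiltMean (hw i) x).const_smul (c i)

lemma gradientMap_mem (hw : ∀ i, IsWeight A (w i)) (x : EuclideanSpace ℝ (Fin n)) :
    gradientMap A S w c x ∈ ∑ i ∈ S, c i • weightHull A (w i) :=
  (Set.mem_finsetSum _ _ _).2
    ⟨_, fun {i} _ => Set.smul_mem_smul_set (tiltMean_mem_weightHull (hw i) x), rfl⟩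

lemma interior_subset_range_gradientMap (hw : ∀ i, IsWeight A (w i)) (hc : ∀ i, 0 ≤ c i) :
    interior (∑ i ∈ S, c i • weightHull A (w i)) ⊆ Set.range (gradientMap A S w c) := by
  intro y hy
  obtain ⟨r, hr, hball⟩ := Metric.nhds_basis_closedBall.mem_iff.1 (mem_interior_iff_mem_nhds.1 hy)
  set Φ : EuclideanSpace ℝ (Fin n) → ℝ := fun x =>
    (∑ i ∈ S, c i * Real.log (laplaceSum A (w i) x)) - innerSL ℝ y x with hΦ
  have hder : ∀ x, HasFDerivAt Φ (innerSL ℝ (gradientMap A S w c x) - innerSL ℝ y) x := by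
    intro x
    have h1 : HasFDerivAt Φ _ x := (HasFDerivAt.fun_sum (u := S) fun i _ =>
      (hasFDerivAt_log_laplaceSum (hw i) x).const_mul (c i)).sub
      ((innerSL ℝ y).hasFDerivAt (x := x))
    refine h1.congr_fderiv ?_
    rw [gradientMap, map_sum]
    simp
  set C := ∑ i ∈ S, c i * ∑ a ∈ A, |Real.log (w i a)| with hC
  have hlow : ∀ x, r * ‖x‖ + -C ≤ Φ x := by
    intro x
    have hz : y + (r / ‖x‖) • x ∈ ∑ i ∈ S, c i • weightHull A (w i) := by
      refine hball ?_
      rw [Metric.mem_closedBall, dist_eq_norm, add_sub_cancel_left, norm_smul, Real.norm_eq_abs,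
        abs_of_nonneg (by positivity)]
      rcases eq_or_ne ‖x‖ 0 with h | h
      · simpa [h] using hr.le
      · rw [div_mul_cancel₀ _ h]
    obtain ⟨g, hg, hsum⟩ := (Set.mem_finsetSum _ _ _).1 hz
    have h1 : inner ℝ (y + (r / ‖x‖) • x) x ≤
        (∑ i ∈ S, c i * Real.log (laplaceSum A (w i) x)) + C := by
      rw [← hsum, sum_inner, hC, ← Finset.sum_add_distrib]
      refine Finset.sum_le_sum fun i hi => ?_
      obtain ⟨z, hz, hgz⟩ := Set.mem_smul_set.1 (hg hi)
      rw [← hgz, real_inner_smul_left, ← mul_add]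
      exact mul_le_mul_of_nonneg_left (inner_le_log_laplaceSum (hw i) hz x) (hc i)
    rw [inner_add_left, real_inner_smul_left, real_inner_self_eq_norm_sq] at h1
    have h2 : r / ‖x‖ * ‖x‖ ^ 2 = r * ‖x‖ := by
      rcases eq_or_ne ‖x‖ 0 with h | h
      · simp [h]
      · field_simp
    simp only [hΦ, innerSL_apply_apply]
    linarith
  have hcont : Continuous Φ := continuous_iff_continuousAt.2 fun x => (hder x).continuousAt
  have htend : Filter.Tendsto Φ (Filter.cocompact _) Filter.atTop :=
    Filter.tendsto_atTop_mono hlow (Filter.tendsto_atTop_add_const_right _ _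
      ((tendsto_norm_cocompact_atTop (E := EuclideanSpace ℝ (Fin n))).const_mul_atTop hr))
  obtain ⟨x, hx⟩ := hcont.exists_forall_le htend
  have hmin : IsLocalMin Φ x := Filter.Eventually.of_forall hx
  have h0 := hmin.hasFDerivAt_eq_zero (hder x)
  refine ⟨x, ?_⟩
  rw [← map_sub] at h0
  have h1 : inner ℝ (gradientMap A S w c x - y) (gradientMap A S w c x - y) = (0 : ℝ) := by
    rw [← innerSL_apply_apply, h0]
    rfl
  exact sub_eq_zero.1 (inner_self_eq_zero.1 h1)

lemma inner_sum_tiltCov_self (x u : EuclideanSpace ℝ (Fin n)) :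
    inner ℝ ((∑ i ∈ S, c i • tiltCov A (w i) x) u) u =
      ∑ i ∈ S, c i * ∑ a ∈ A, tiltWeight A (w i) x a *
        inner ℝ (a - tiltMean A (w i) x) u ^ 2 := by
  rw [sum_apply, sum_inner]
  refine Finset.sum_congr rfl fun i _ => ?_
  rw [smul_apply, real_inner_smul_left, inner_tiltCov_self]

lemma inner_sum_tiltCov_self_pos (hw : ∀ i, IsWeight A (w i)) (hc : ∀ i, 0 < c i)
    {u : EuclideanSpace ℝ (Fin n)}
    (hu : ∃ i ∈ S, ∃ a ∈ A, ∃ b ∈ A, 0 < w i a ∧ 0 < w i b ∧ inner ℝ (a - b) u ≠ (0 : ℝ))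
    (x : EuclideanSpace ℝ (Fin n)) :
    0 < inner ℝ ((∑ i ∈ S, c i • tiltCov A (w i) x) u) u := by
  rw [inner_sum_tiltCov_self]
  obtain ⟨i, hi, a, ha, b, hb, hwa, hwb, hab⟩ := hu
  have hnn : ∀ i, ∀ a ∈ A, 0 ≤ tiltWeight A (w i) x a *
        inner ℝ (a - tiltMean A (w i) x) u ^ 2 :=
    fun i a ha => mul_nonneg (tiltWeight_nonneg (hw i) x a ha) (sq_nonneg _)
  refine Finset.sum_pos' (fun i _ => mul_nonneg (hc i).le (Finset.sum_nonneg (hnn i)))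
    ⟨i, hi, mul_pos (hc i) (Finset.sum_pos' (hnn i) ?_)⟩
  by_cases h : inner ℝ (a - tiltMean A (w i) x) u = (0 : ℝ)
  · refine ⟨b, hb, mul_pos (tiltWeight_pos (hw i) x hwb) (sq_pos_of_ne_zero fun h' => hab ?_)⟩
    rw [← sub_sub_sub_cancel_right a b (tiltMean A (w i) x), inner_sub_left, h, h', sub_zero]
  · exact ⟨a, ha, mul_pos (tiltWeight_pos (hw i) x hwa) (sq_pos_of_ne_zero h)⟩

lemma gradientMap_injective (hw : ∀ i, IsWeight A (w i)) (hc : ∀ i, 0 < c i)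
    (h : ∀ u ≠ 0, ∃ i ∈ S, ∃ a ∈ A, ∃ b ∈ A,
      0 < w i a ∧ 0 < w i b ∧ inner ℝ (a - b) u ≠ (0 : ℝ)) :
    Function.Injective (gradientMap A S w c) := by
  intro x y hxy
  by_contra hne
  set u := x - y with hu
  have hder : ∀ t : ℝ, HasDerivAt (fun t : ℝ => innerSL ℝ u (gradientMap A S w c (y + t • u)))
      (innerSL ℝ u ((∑ i ∈ S, c i • tiltCov A (w i) (y + t • u)) u)) t := by
    intro t
    have h1 : HasDerivAt (fun t : ℝ => y + t • u) u t := by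
      simpa using ((hasDerivAt_id t).smul_const u).const_add y
    exact (innerSL ℝ u).hasFDerivAt.comp_hasDerivAt t
      (HasFDerivAt.comp_hasDerivAt (f := fun t : ℝ => y + t • u) t
        (hasFDerivAt_gradientMap (S := S) (c := c) hw (y + t • u)) h1)
  have hmono := strictMono_of_deriv_pos fun t => by
    rw [(hder t).deriv, innerSL_apply_apply, real_inner_comm]
    exact inner_sum_tiltCov_self_pos hw hc (h u (sub_ne_zero.2 hne)) _
  have := hmono zero_lt_one
  simp [hu, hxy] at this

lemma volume_eq_zero_of_inner_eq {P : Set (EuclideanSpace ℝ (Fin n))}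
    {u : EuclideanSpace ℝ (Fin n)} (hu : u ≠ 0) {d : ℝ} (h : ∀ z ∈ P, inner ℝ z u = d) :
    volume P = 0 := by
  rcases P.eq_empty_or_nonempty with rfl | ⟨z, hz⟩
  · simp
  set s := AffineSubspace.mk' z (LinearMap.ker (innerSL ℝ u).toLinearMap) with hs
  refine measure_mono_null (t := (s : Set (EuclideanSpace ℝ (Fin n)))) ?_
    (Measure.addHaar_affineSubspace _ s ?_)
  · intro y hy
    rw [SetLike.mem_coe, hs, AffineSubspace.mem_mk', LinearMap.mem_ker]
    change inner ℝ u (y - z) = 0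
    rw [real_inner_comm, inner_sub_left, h y hy, h z hz, sub_self]
  · intro htop
    have h1 : s.direction = ⊤ := by rw [htop, AffineSubspace.direction_top]
    rw [hs, AffineSubspace.direction_mk'] at h1
    have h2 : u ∈ LinearMap.ker (innerSL ℝ u).toLinearMap := h1 ▸ Submodule.mem_top
    exact hu (inner_self_eq_zero.1 (LinearMap.mem_ker.1 h2))

lemma det_sum_tiltCov (x : EuclideanSpace ℝ (Fin n)) :
    (∑ i ∈ S, c i • tiltCov A (w i) x).det = (∑ i ∈ S, c i • tiltCovMatrix A (w i) x).det := by
  rw [ContinuousLinearMap.det,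
    ← LinearMap.det_toMatrix (EuclideanSpace.basisFun (Fin n) ℝ).toBasis]
  congr 1
  simp_rw [← toMatrix_tiltCov]
  simp only [← map_smul, ← map_sum]
  congr 1
  ext1 u
  simp

lemma det_sum_tiltCovMatrix_nonneg (hw : ∀ i, IsWeight A (w i)) (hc : ∀ i, 0 ≤ c i)
    (x : EuclideanSpace ℝ (Fin n)) : 0 ≤ (∑ i ∈ S, c i • tiltCovMatrix A (w i) x).det := by
  refine Matrix.PosSemidef.det_nonneg ?_
  refine Matrix.posSemidef_sum _ fun i _ => (Matrix.posSemidef_sum _ fun a ha => ?_).smul (hc i)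
  exact (Matrix.posSemidef_vecMulVec_self_star _).smul (tiltWeight_nonneg (hw i) x a ha)

/-- The volume of a Minkowski sum of polytopes is the integral of the determinant of the
Hessian of the corresponding potential. -/
theorem volume_sum_weightHull (hw : ∀ i, IsWeight A (w i)) (hc : ∀ i, 0 < c i) :
    volume (∑ i ∈ S, c i • weightHull A (w i)) =
      ∫⁻ x, ENNReal.ofReal (∑ i ∈ S, c i • tiltCovMatrix A (w i) x).det := by
  by_cases h : ∀ u ≠ 0, ∃ i ∈ S, ∃ a ∈ A, ∃ b ∈ A,
      0 < w i a ∧ 0 < w i b ∧ inner ℝ (a - b) u ≠ (0 : ℝ)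
  · have key := lintegral_abs_det_fderiv_eq_addHaar_image volume MeasurableSet.univ
      (fun x _ => (hasFDerivAt_gradientMap (S := S) (c := c) hw x).hasFDerivWithinAt)
      (gradientMap_injective hw hc h).injOn
    simp_rw [det_sum_tiltCov, abs_of_nonneg (det_sum_tiltCovMatrix_nonneg hw
      (fun i => (hc i).le) _)] at key
    rw [Measure.restrict_univ] at key
    rw [key, Set.image_univ]
    refine le_antisymm ?_ (measure_mono (Set.range_subset_iff.2 fun x => gradientMap_mem hw x))
    have hconv : Convex ℝ (∑ i ∈ S, c i • weightHull A (w i)) :=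
      convex_sum _ fun i _ => (convex_convexHull ℝ _).smul (c i)
    calc volume (∑ i ∈ S, c i • weightHull A (w i))
        ≤ volume (interior (∑ i ∈ S, c i • weightHull A (w i)) ∪
            frontier (∑ i ∈ S, c i • weightHull A (w i))) := measure_mono fun x hx => by
          rw [← closure_eq_interior_union_frontier]; exact subset_closure hx
      _ ≤ volume (interior (∑ i ∈ S, c i • weightHull A (w i))) + 0 := by
          rw [← hconv.addHaar_frontier volume]; exact measure_union_le _ _
      _ ≤ volume (Set.range (gradientMap A S w c)) := by
          rw [add_zero]
          exact measure_mono (interior_subset_range_gradientMap hw fun i => (hc i).le)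
  · push Not at h
    obtain ⟨u, hu, h⟩ := h
    choose b hb hwb using fun i => (hw i).2
    have hyp : ∀ i ∈ S, ∀ z ∈ weightHull A (w i), inner ℝ z u = inner ℝ (b i) u := by
      intro i hi z hz
      have hconv : Convex ℝ {z : EuclideanSpace ℝ (Fin n) | inner ℝ z u = inner ℝ (b i) u} := by
        refine convex_hyperplane ⟨fun a b => inner_add_left a b u, fun c a => ?_⟩ _
        rw [real_inner_smul_left, smul_eq_mul]
      refine convexHull_min ?_ hconv hz
      rintro a ⟨ha, hwa⟩
      have := h i hi a ha (b i) (hb i) hwa (hwb i)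
      rwa [inner_sub_left, sub_eq_zero] at this
    have hdet : ∀ x, (∑ i ∈ S, c i • tiltCovMatrix A (w i) x).det = 0 := by
      intro x
      rw [← det_sum_tiltCov, ContinuousLinearMap.det]
      refine LinearMap.det_eq_zero_iff_ker_ne_bot.2 fun hbot => hu ?_
      refine (LinearMap.ker_eq_bot'.1 hbot) u ?_
      change (∑ i ∈ S, c i • tiltCov A (w i) x) u = 0
      rw [sum_apply]
      refine Finset.sum_eq_zero fun i hi => ?_
      rw [smul_apply, tiltCov_apply, Finset.sum_eq_zero, smul_zero]
      intro a ha
      by_cases hwa : 0 < w i a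
      · rw [inner_sub_left, hyp i hi a (subset_convexHull ℝ _ ⟨ha, hwa⟩),
          hyp i hi _ (tiltMean_mem_weightHull (hw i) x), sub_self, zero_smul, smul_zero]
      · have : w i a = 0 := le_antisymm (not_lt.1 hwa) ((hw i).1 a ha)
        simp [tiltWeight, this]
    rw [volume_eq_zero_of_inner_eq hu (d := ∑ i ∈ S, c i * inner ℝ (b i) u)]
    · simp [hdet]
    · intro z hz
      obtain ⟨g, hg, rfl⟩ := (Set.mem_finsetSum _ _ _).1 hz
      rw [sum_inner]
      refine Finset.sum_congr rfl fun i hi => ?_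
      obtain ⟨y, hy, hgy⟩ := Set.mem_smul_set.1 (hg hi)
      rw [← hgy, real_inner_smul_left]
      congr 1
      exact hyp i hi y hy

end VolumeFormula

section Polytopes

variable {n : ℕ} {A : Finset (EuclideanSpace ℝ (Fin n))}

lemma isCompact_sum {ι E : Type*} [AddCommMonoid E] [TopologicalSpace E] [ContinuousAdd E]
    (S : Finset ι) {K : ι → Set E} (hK : ∀ i, IsCompact (K i)) : IsCompact (∑ i ∈ S, K i) := by
  classical
  induction S using Finset.induction_on with
  | empty => simp
  | insert i S hi ih => rw [Finset.sum_insert hi]; exact (hK i).add ih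

lemma isCompact_weightHull (w : EuclideanSpace ℝ (Fin n) → ℝ) :
    IsCompact (weightHull A w) :=
  Set.Finite.isCompact_convexHull ℝ (A.finite_toSet.subset fun _ ha => ha.1)

lemma continuous_tiltMean {w : EuclideanSpace ℝ (Fin n) → ℝ} (hw : IsWeight A w) :
    Continuous (tiltMean A w) :=
  continuous_iff_continuousAt.2 fun x => (hasFDerivAt_tiltMean hw x).continuousAt

lemma continuous_tiltCovMatrix {w : EuclideanSpace ℝ (Fin n) → ℝ} (hw : IsWeight A w) :
    Continuous (tiltCovMatrix A w) := by
  have hm := continuous_tiltMean hw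
  have hZ : Continuous (laplaceSum A w) :=
    continuous_iff_continuousAt.2 fun x => (hasFDerivAt_laplaceSum x).continuousAt
  refine continuous_finsetSum _ fun a _ => ?_
  have h1 : Continuous fun x => tiltWeight A w x a := by
    refine Continuous.div ?_ hZ fun x => (laplaceSum_pos hw x).ne'
    fun_prop
  have h2 : Continuous fun x => (fun j => (a - tiltMean A w x) j : Fin n → ℝ) := by
    refine continuous_pi fun j => ?_
    fun_prop
  exact h1.smul (h2.matrix_vecMulVec h2)

lemma mixedDet_smul_tiltCovMatrix_nonneg {w : Fin n → EuclideanSpace ℝ (Fin n) → ℝ}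
    {c : Fin n → ℝ} (hw : ∀ i, IsWeight A (w i)) (hc : ∀ i, 0 < c i)
    (x : EuclideanSpace ℝ (Fin n)) :
    0 ≤ mixedDet (fun i => c i • tiltCovMatrix A (w i) x) := by
  rw [mixedDet_smul]
  exact mul_nonneg (Finset.prod_nonneg fun i _ => (hc i).le)
    (mixedDet_nonneg A _ _ fun i => tiltWeight_nonneg (hw i) x)

lemma integrable_and_integral_mixedDet {w : Fin n → EuclideanSpace ℝ (Fin n) → ℝ}
    {c : Fin n → ℝ} (hw : ∀ i, IsWeight A (w i)) (hc : ∀ i, 0 < c i) :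
    Integrable (fun x => mixedDet (fun i => c i • tiltCovMatrix A (w i) x)) ∧
      ∫ x, mixedDet (fun i => c i • tiltCovMatrix A (w i) x) =
        n.factorial * mixedVol n (fun i => c i • weightHull A (w i)) := by
  have hnn : ∀ S : Finset (Fin n), ∀ x, 0 ≤ (∑ i ∈ S, c i • tiltCovMatrix A (w i) x).det :=
    fun S x => det_sum_tiltCovMatrix_nonneg hw (fun i => (hc i).le) x
  have hcont : ∀ S : Finset (Fin n),
      Continuous fun x => (∑ i ∈ S, c i • tiltCovMatrix A (w i) x).det := fun S =>
    Continuous.matrix_det (continuous_finsetSum _ fun i _ =>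
      (continuous_tiltCovMatrix (hw i)).const_smul (c i))
  have hterm : ∀ S : Finset (Fin n),
      Integrable fun x => (∑ i ∈ S, c i • tiltCovMatrix A (w i) x).det := fun S => by
    refine (lintegral_ofReal_ne_top_iff_integrable (hcont S).aestronglyMeasurable
      (Filter.Eventually.of_forall (hnn S))).1 ?_
    rw [← volume_sum_weightHull hw hc]
    exact (isCompact_sum S fun i => (isCompact_weightHull (w i)).smul (c i)).measure_ne_top
  have hval : ∀ S : Finset (Fin n),
      ∫ x, (∑ i ∈ S, c i • tiltCovMatrix A (w i) x).det =
        (volume (∑ i ∈ S, c i • weightHull A (w i))).toReal := fun S => by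
    rw [volume_sum_weightHull hw hc, integral_eq_lintegral_of_nonneg_ae
      (Filter.Eventually.of_forall (hnn S)) (hcont S).aestronglyMeasurable]
  simp_rw [← sum_neg_one_pow_mul_det]
  refine ⟨integrable_finsetSum _ fun S _ => (hterm S).const_mul _, ?_⟩
  rw [integral_finsetSum _ fun S _ => (hterm S).const_mul _, mixedVol, mul_inv_cancel_left₀
    (by positivity)]
  refine Finset.sum_congr rfl fun S _ => ?_
  rw [integral_const_mul, hval]

lemma mixedVol_smul_weightHull {w : Fin n → EuclideanSpace ℝ (Fin n) → ℝ}
    {c : Fin n → ℝ} (hw : ∀ i, IsWeight A (w i)) (hc : ∀ i, 0 < c i) :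
    mixedVol n (fun i => c i • weightHull A (w i)) =
      (∏ i, c i) * mixedVol n (fun i => weightHull A (w i)) := by
  have h1 := (integrable_and_integral_mixedDet hw hc).2
  have h2 := (integrable_and_integral_mixedDet hw (c := fun _ => 1) fun _ => one_pos).2
  simp_rw [mixedDet_smul, integral_const_mul] at h1
  simp only [one_smul] at h2
  rw [h2] at h1
  have h3 : (n.factorial : ℝ) ≠ 0 := by positivity
  refine mul_left_cancel₀ h3 ?_
  rw [← h1]
  ring

open Filter Topology in
lemma tendsto_tiltCovMatrix {w : EuclideanSpace ℝ (Fin n) → ℝ} (hw : IsWeight A w)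
    {W : ℕ → EuclideanSpace ℝ (Fin n) → ℝ} (hW : ∀ a, Tendsto (fun m => W m a) atTop (𝓝 (w a)))
    (x : EuclideanSpace ℝ (Fin n)) :
    Tendsto (fun m => tiltCovMatrix A (W m) x) atTop (𝓝 (tiltCovMatrix A w x)) := by
  have h1 : Tendsto (fun m => laplaceSum A (W m) x) atTop (𝓝 (laplaceSum A w x)) :=
    tendsto_finsetSum _ fun a _ => (hW a).mul_const _
  have h2 : ∀ a, Tendsto (fun m => tiltWeight A (W m) x a) atTop (𝓝 (tiltWeight A w x a)) :=
    fun a => ((hW a).mul_const _).div h1 (laplaceSum_pos hw x).ne'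
  have h3 : Tendsto (fun m => tiltMean A (W m) x) atTop (𝓝 (tiltMean A w x)) :=
    tendsto_finsetSum _ fun a _ => (h2 a).smul_const a
  refine tendsto_finsetSum _ fun a _ => (h2 a).smul ?_
  have hc : Continuous fun y : EuclideanSpace ℝ (Fin n) =>
      Matrix.vecMulVec (fun j => (a - y) j) (fun j => (a - y) j) := by
    have : Continuous fun y : EuclideanSpace ℝ (Fin n) => (fun j => (a - y) j : Fin n → ℝ) :=
      continuous_pi fun j => by fun_prop
    exact this.matrix_vecMulVec this
  exact (hc.tendsto _).comp h3

lemma continuous_mixedDet : Continuous (mixedDet (n := n)) := by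
  refine continuous_finsetSum _ fun σ _ => Continuous.matrix_det ?_
  refine continuous_matrix fun i j => ?_
  change Continuous fun p : Fin n → Matrix (Fin n) (Fin n) ℝ => p (σ i) i j
  fun_prop

open Filter Topology in
lemma mixedVol_weightHull_mono {w w' : Fin n → EuclideanSpace ℝ (Fin n) → ℝ}
    (hw : ∀ i, IsWeight A (w i)) (hw' : ∀ i, IsWeight A (w' i))
    (h : ∀ i, ∀ a ∈ A, 0 < w i a → 0 < w' i a) :
    mixedVol n (fun i => weightHull A (w i)) ≤ mixedVol n (fun i => weightHull A (w' i)) := by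
  set W : ℕ → Fin n → EuclideanSpace ℝ (Fin n) → ℝ :=
    fun m i a => w i a + (1 / ((m : ℝ) + 1)) * w' i a with hWdef
  have hpos : ∀ m : ℕ, (0 : ℝ) < 1 / ((m : ℝ) + 1) := fun m => Nat.one_div_pos_of_nat
  have hW : ∀ m i, IsWeight A (W m i) := fun m i => by
    refine ⟨fun a ha => add_nonneg ((hw i).1 a ha) (mul_nonneg (hpos m).le ((hw' i).1 a ha)), ?_⟩
    obtain ⟨a, ha, hwa⟩ := (hw i).2
    exact ⟨a, ha, add_pos_of_pos_of_nonneg hwa (mul_nonneg (hpos m).le ((hw' i).1 a ha))⟩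
  have hhull : ∀ m i, weightHull A (W m i) = weightHull A (w' i) := fun m i => by
    rw [weightHull, weightHull]
    congr 1
    ext a
    refine and_congr_right fun ha => ⟨fun hWa => ?_, fun hwa =>
      add_pos_of_nonneg_of_pos ((hw i).1 a ha) (mul_pos (hpos m) hwa)⟩
    by_contra hn
    have h1 : w' i a = 0 := le_antisymm (not_lt.1 hn) ((hw' i).1 a ha)
    have h2 : 0 < w i a := by simpa [hWdef, h1] using hWa
    exact hn (h i a ha h2)
  have htend : ∀ i a, Tendsto (fun m => W m i a) atTop (𝓝 (w i a)) := fun i a => by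
    simpa [hWdef] using (tendsto_one_div_add_atTop_nhds_zero_nat (𝕜 := ℝ)).mul_const (w' i a)
      |>.const_add (w i a)
  have hval : ∀ {w : Fin n → EuclideanSpace ℝ (Fin n) → ℝ}, (∀ i, IsWeight A (w i)) →
      ∫⁻ x, ENNReal.ofReal (mixedDet fun i => tiltCovMatrix A (w i) x) =
        ENNReal.ofReal (n.factorial * mixedVol n (fun i => weightHull A (w i))) ∧
      0 ≤ mixedVol n (fun i => weightHull A (w i)) := fun {w} hw => by
    have h1 := integrable_and_integral_mixedDet hw (c := fun _ => 1) fun _ => one_pos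
    have h2 := mixedDet_smul_tiltCovMatrix_nonneg hw (c := fun _ => 1) fun _ => one_pos
    simp only [one_smul] at h1 h2
    refine ⟨by rw [← h1.2, ofReal_integral_eq_lintegral_ofReal h1.1
      (Filter.Eventually.of_forall h2)], ?_⟩
    have h3 : 0 ≤ n.factorial * mixedVol n (fun i => weightHull A (w i)) := by
      rw [← h1.2]; exact integral_nonneg h2
    exact nonneg_of_mul_nonneg_right h3 (by positivity)
  have hcont : ∀ m, Continuous fun x => mixedDet fun i => tiltCovMatrix A (W m i) x := fun m =>
    continuous_mixedDet.comp (continuous_pi fun i => continuous_tiltCovMatrix (hW m i))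
  have hlim : ∀ x, liminf (fun m => ENNReal.ofReal
      (mixedDet fun i => tiltCovMatrix A (W m i) x)) atTop =
      ENNReal.ofReal (mixedDet fun i => tiltCovMatrix A (w i) x) := fun x => by
    refine Tendsto.liminf_eq (ENNReal.tendsto_ofReal ?_)
    exact (continuous_mixedDet.tendsto _).comp
      (tendsto_pi_nhds.2 fun i => tendsto_tiltCovMatrix (hw i) (htend i) x)
  have key := lintegral_liminf_le (μ := volume) (u := atTop)
    fun m => (hcont m).measurable.ennreal_ofReal
  simp_rw [hlim, (hval hw).1, fun m => (hval (hW m)).1, hhull, liminf_const] at key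
  rw [ENNReal.ofReal_le_ofReal_iff (mul_nonneg (by positivity) (hval hw').2)] at key
  exact le_of_mul_le_mul_left key (by positivity)

open Classical in
lemma weightHull_indicator {T : Finset (EuclideanSpace ℝ (Fin n))} (hT : T ⊆ A) :
    weightHull A (fun a => if a ∈ T then 1 else 0) =
      convexHull ℝ (T : Set (EuclideanSpace ℝ (Fin n))) := by
  rw [weightHull]
  congr 1
  ext a
  by_cases h : a ∈ T
  · simp [h, hT h]
  · simp [h]

open Classical in
lemma isWeight_indicator {T : Finset (EuclideanSpace ℝ (Fin n))} (hT : T ⊆ A)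
    (hne : T.Nonempty) : IsWeight A (fun a => if a ∈ T then 1 else 0) := by
  refine ⟨fun a _ => by dsimp only; split_ifs <;> norm_num, ?_⟩
  obtain ⟨a, ha⟩ := hne
  exact ⟨a, hT ha, by simp [ha]⟩

lemma mixedVol_convexHull_mono {T T' : Fin n → Finset (EuclideanSpace ℝ (Fin n))}
    (hne : ∀ i, (T i).Nonempty) (h : ∀ i, T i ⊆ T' i) :
    mixedVol n (fun i => convexHull ℝ (T i : Set (EuclideanSpace ℝ (Fin n)))) ≤
      mixedVol n (fun i => convexHull ℝ (T' i : Set (EuclideanSpace ℝ (Fin n)))) := by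
  classical
  set A := Finset.univ.biUnion T'
  have hA' : ∀ i, T' i ⊆ A := fun i => Finset.subset_biUnion_of_mem T' (Finset.mem_univ i)
  have hA : ∀ i, T i ⊆ A := fun i => (h i).trans (hA' i)
  simp_rw [← fun i => weightHull_indicator (hA i), ← fun i => weightHull_indicator (hA' i)]
  refine mixedVol_weightHull_mono (fun i => isWeight_indicator (hA i) (hne i))
    (fun i => isWeight_indicator (hA' i) ((hne i).mono (h i))) fun i a _ ha => ?_
  by_cases haT : a ∈ T i
  · simp [h i haT]
  · simp [haT] at ha

lemma mixedVol_smul_convexHull {T : Fin n → Finset (EuclideanSpace ℝ (Fin n))}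
    (hne : ∀ i, (T i).Nonempty) {c : Fin n → ℝ} (hc : ∀ i, 0 < c i) :
    mixedVol n (fun i => c i • convexHull ℝ (T i : Set (EuclideanSpace ℝ (Fin n)))) =
      (∏ i, c i) * mixedVol n (fun i => convexHull ℝ (T i : Set (EuclideanSpace ℝ (Fin n)))) := by
  classical
  set A := Finset.univ.biUnion T
  have hA : ∀ i, T i ⊆ A := fun i => Finset.subset_biUnion_of_mem T (Finset.mem_univ i)
  simp_rw [← fun i => weightHull_indicator (hA i)]
  exact mixedVol_smul_weightHull (fun i => isWeight_indicator (hA i) (hne i)) hc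

end Polytopes

section ConvexBodies

open Filter Topology

variable {n : ℕ}

lemma sum_closure_subset {ι : Type*} (S : Finset ι) (K : ι → Set (EuclideanSpace ℝ (Fin n))) :
    ∑ i ∈ S, closure (K i) ⊆ closure (∑ i ∈ S, K i) := by
  classical
  induction S using Finset.induction_on with
  | empty => simp
  | insert i S hi ih =>
    rw [Finset.sum_insert hi, Finset.sum_insert hi]
    refine (Set.add_subset_add_left ih).trans ?_
    rintro _ ⟨a, ha, b, hb, rfl⟩
    exact map_mem_closure₂ continuous_add ha hb fun a ha b hb => Set.add_mem_add ha hb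

lemma sum_subset_sum_sets {ι E : Type*} [AddCommMonoid E] (S : Finset ι) {K L : ι → Set E}
    (h : ∀ i, K i ⊆ L i) : ∑ i ∈ S, K i ⊆ ∑ i ∈ S, L i :=
  Set.finsetSum_subset_finsetSum _ _ _ fun i _ => h i

lemma sum_iUnion_subset {ι E : Type*} [AddCommMonoid E] (S : Finset ι) {U : ι → ℕ → Set E}
    (hU : ∀ i, Monotone (U i)) : ∑ i ∈ S, (⋃ m, U i m) ⊆ ⋃ m, ∑ i ∈ S, U i m := by
  classical
  induction S using Finset.induction_on with
  | empty => simp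
  | insert i S hi ih =>
    rw [Finset.sum_insert hi]
    refine (Set.add_subset_add_left ih).trans ?_
    rintro _ ⟨a, ha, b, hb, rfl⟩
    obtain ⟨k, hk⟩ := Set.mem_iUnion.1 ha
    obtain ⟨l, hl⟩ := Set.mem_iUnion.1 hb
    refine Set.mem_iUnion.2 ⟨max k l, ?_⟩
    rw [Finset.sum_insert hi]
    exact Set.add_mem_add (hU i (le_max_left k l) hk)
      (sum_subset_sum_sets S (fun i => hU i (le_max_right k l)) hl)

/-- A sequence of convex sets increases to `K` up to closure. -/
structure Exhausts (U : ℕ → Set (EuclideanSpace ℝ (Fin n)))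
    (K : Set (EuclideanSpace ℝ (Fin n))) : Prop where
  mono : Monotone U
  convex : ∀ m, Convex ℝ (U m)
  subset : ∀ m, U m ⊆ K
  dense : K ⊆ closure (⋃ m, U m)

lemma Exhausts.smul {U : ℕ → Set (EuclideanSpace ℝ (Fin n))}
    {K : Set (EuclideanSpace ℝ (Fin n))} (h : Exhausts U K) (c : ℝ) :
    Exhausts (fun m => c • U m) (c • K) where
  mono _ _ hkl := Set.smul_set_mono (h.mono hkl)
  convex m := (h.convex m).smul c
  subset m := Set.smul_set_mono (h.subset m)
  dense := by
    rw [← Set.smul_set_iUnion]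
    rintro _ ⟨x, hx, rfl⟩
    exact map_mem_closure (continuous_const_smul c) (h.dense hx)
      fun y hy => Set.smul_mem_smul_set hy

lemma tendsto_volume_sum {ι : Type*} (S : Finset ι)
    {U : ι → ℕ → Set (EuclideanSpace ℝ (Fin n))} {K : ι → Set (EuclideanSpace ℝ (Fin n))}
    (hK : ∀ i, IsCompact (K i)) (h : ∀ i, Exhausts (U i) (K i)) :
    Tendsto (fun m => (volume (∑ i ∈ S, U i m)).toReal) atTop
      (𝓝 (volume (∑ i ∈ S, K i)).toReal) := by
  have hmono : Monotone fun m => ∑ i ∈ S, U i m :=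
    fun k l hkl => sum_subset_sum_sets S fun i => (h i).mono hkl
  have hconv : Convex ℝ (⋃ m, ∑ i ∈ S, U i m) :=
    hmono.directed_le.convex_iUnion fun m => convex_sum _ fun i _ => (h i).convex m
  have hvol : volume (⋃ m, ∑ i ∈ S, U i m) = volume (∑ i ∈ S, K i) := by
    refine le_antisymm (measure_mono (Set.iUnion_subset fun m =>
      sum_subset_sum_sets S fun i => (h i).subset m)) ?_
    calc volume (∑ i ∈ S, K i) ≤ volume (closure (⋃ m, ∑ i ∈ S, U i m)) :=
          measure_mono <| (sum_subset_sum_sets S fun i => (h i).dense).trans <|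
            (sum_closure_subset S _).trans <|
              closure_mono (sum_iUnion_subset S fun i => (h i).mono)
      _ ≤ volume ((⋃ m, ∑ i ∈ S, U i m) ∪ frontier (⋃ m, ∑ i ∈ S, U i m)) := by
          rw [← closure_eq_self_union_frontier]
      _ ≤ volume (⋃ m, ∑ i ∈ S, U i m) + 0 := by
          rw [← hconv.addHaar_frontier volume]; exact measure_union_le _ _
      _ = _ := add_zero _
  rw [← hvol]
  refine (ENNReal.tendsto_toReal ?_).comp (tendsto_measure_iUnion_atTop hmono)
  rw [hvol]
  exact (isCompact_sum S hK).measure_ne_top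

lemma tendsto_mixedVol {U : Fin n → ℕ → Set (EuclideanSpace ℝ (Fin n))}
    {K : Fin n → Set (EuclideanSpace ℝ (Fin n))}
    (hK : ∀ i, IsCompact (K i)) (h : ∀ i, Exhausts (U i) (K i)) :
    Tendsto (fun m => mixedVol n fun i => U i m) atTop (𝓝 (mixedVol n K)) :=
  (tendsto_finsetSum _ fun S _ => (tendsto_volume_sum S hK h).const_mul _).const_mul _

lemma exists_exhausts {K : Set (EuclideanSpace ℝ (Fin n))} (hK : K.Nonempty) :
    ∃ T : ℕ → Finset (EuclideanSpace ℝ (Fin n)), Monotone T ∧ (∀ m, (T m).Nonempty) ∧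
      (∀ m, (T m : Set (EuclideanSpace ℝ (Fin n))) ⊆ K) ∧
      K ⊆ closure (⋃ m, (T m : Set (EuclideanSpace ℝ (Fin n)))) := by
  classical
  have : Nonempty K := hK.to_subtype
  refine ⟨fun m => (Finset.range (m + 1)).image
    fun k => (TopologicalSpace.denseSeq K k : EuclideanSpace ℝ (Fin n)), ?_, ?_, ?_, ?_⟩
  · exact fun k l hkl => Finset.image_subset_image (Finset.range_mono (by lia))
  · exact fun m => by simp
  · intro m x hx
    obtain ⟨k, -, rfl⟩ := Finset.mem_image.1 (Finset.mem_coe.1 hx)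
    exact Subtype.prop _
  · intro x hx
    have h1 := TopologicalSpace.denseRange_denseSeq K ⟨x, hx⟩
    refine map_mem_closure continuous_subtype_val h1 ?_
    rintro _ ⟨k, rfl⟩
    refine Set.mem_iUnion.2 ⟨k, ?_⟩
    exact Finset.mem_coe.2 (Finset.mem_image.2 ⟨k, by simp, rfl⟩)

lemma exhausts_convexHull {K : Set (EuclideanSpace ℝ (Fin n))} (hK : Convex ℝ K)
    {T : ℕ → Finset (EuclideanSpace ℝ (Fin n))} (hT : Monotone T)
    (hsub : ∀ m, (T m : Set (EuclideanSpace ℝ (Fin n))) ⊆ K)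
    (hdense : K ⊆ closure (⋃ m, (T m : Set (EuclideanSpace ℝ (Fin n))))) :
    Exhausts (fun m => convexHull ℝ (T m : Set (EuclideanSpace ℝ (Fin n)))) K where
  mono _ _ hkl := convexHull_mono (Finset.coe_subset.2 (hT hkl))
  convex _ := convex_convexHull ℝ _
  subset m := convexHull_min (hsub m) hK
  dense := hdense.trans (closure_mono (Set.iUnion_mono fun _ => subset_convexHull ℝ _))

/-- Monotonicity of mixed volumes. -/
theorem mixedVol_mono {K L : Fin n → Set (EuclideanSpace ℝ (Fin n))}
    (hK : ∀ i, IsConvexBody (K i)) (hL : ∀ i, IsConvexBody (L i)) (h : ∀ i, K i ⊆ L i) :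
    mixedVol n K ≤ mixedVol n L := by
  classical
  choose T hTm hTn hTs hTd using fun i => exists_exhausts (hK i).2.2
  choose R hRm hRn hRs hRd using fun i => exists_exhausts (hL i).2.2
  set R' : Fin n → ℕ → Finset (EuclideanSpace ℝ (Fin n)) := fun i m => T i m ∪ R i m
  have hK' := fun i => exhausts_convexHull (hK i).1 (hTm i) (hTs i) (hTd i)
  have hL' : ∀ i, Exhausts (fun m => convexHull ℝ (R' i m : Set _)) (L i) := fun i => by
    refine exhausts_convexHull (hL i).1 ?_ ?_ ?_
    · exact fun k l hkl => Finset.union_subset_union (hTm i hkl) (hRm i hkl)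
    · intro m
      rw [Finset.coe_union]
      exact Set.union_subset ((hTs i m).trans (h i)) (hRs i m)
    · refine (hRd i).trans (closure_mono (Set.iUnion_mono fun m => ?_))
      exact Finset.coe_subset.2 Finset.subset_union_right
  have h1 := tendsto_mixedVol (fun i => (hK i).2.1) hK'
  have h2 := tendsto_mixedVol (fun i => (hL i).2.1) hL'
  exact le_of_tendsto_of_tendsto' h1 h2 fun m =>
    mixedVol_convexHull_mono (fun i => hTn i m) fun i => Finset.subset_union_left

/-- Homogeneity of mixed volumes. -/
theorem mixedVol_smul {K : Fin n → Set (EuclideanSpace ℝ (Fin n))}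
    (hK : ∀ i, IsConvexBody (K i)) {c : Fin n → ℝ} (hc : ∀ i, 0 < c i) :
    mixedVol n (fun i => c i • K i) = (∏ i, c i) * mixedVol n K := by
  choose T hTm hTn hTs hTd using fun i => exists_exhausts (hK i).2.2
  have hex := fun i => exhausts_convexHull (hK i).1 (hTm i) (hTs i) (hTd i)
  have h1 := tendsto_mixedVol (fun i => (hK i).2.1.smul (c i)) fun i => (hex i).smul (c i)
  have h2 := (tendsto_mixedVol (fun i => (hK i).2.1) hex).const_mul (∏ i, c i)
  refine tendsto_nhds_unique h1 (h2.congr fun m => ?_)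
  exact (mixedVol_smul_convexHull (fun i => hTn i m) hc).symm

end ConvexBodies

section Simplex

open Filter Topology

variable {n : ℕ} (b : AffineBasis (Fin (n + 1)) ℝ (EuclideanSpace ℝ (Fin n)))

lemma coord_eq_linear_add (i : Fin (n + 1)) (x : EuclideanSpace ℝ (Fin n)) :
    b.coord i x = (b.coord i).linear x + b.coord i 0 := by
  have := (b.coord i).map_vadd 0 x
  simpa using this

lemma sum_linear_coord (x : EuclideanSpace ℝ (Fin n)) :
    ∑ i, (b.coord i).linear x = 0 := by
  have h1 := b.sum_coord_apply_eq_one x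
  have h2 := b.sum_coord_apply_eq_one 0
  simp_rw [coord_eq_linear_add b _ x, Finset.sum_add_distrib, h2] at h1
  linarith

lemma linear_coord_apply_vertex (i k : Fin (n + 1)) :
    (b.coord i).linear (b k) = (if i = k then 1 else 0) - b.coord i 0 := by
  have := coord_eq_linear_add b i (b k)
  rw [b.coord_apply] at this
  linarith

lemma mem_smul_simplex {s : ℝ} (hs : 0 < s) (x : EuclideanSpace ℝ (Fin n)) :
    x ∈ s • convexHull ℝ (Set.range b) ↔ ∀ i, 0 ≤ (b.coord i).linear x + s * b.coord i 0 := by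
  rw [Set.mem_smul_set_iff_inv_smul_mem₀ hs.ne', b.convexHull_eq_nonneg_coord]
  refine forall_congr' fun i => ?_
  rw [coord_eq_linear_add, map_smul, smul_eq_mul, ← mul_nonneg_iff_of_pos_left hs, mul_add,
    mul_inv_cancel_left₀ hs.ne']

/-- The polyhedron cut out by the facet inequalities of the simplex with right-hand side `β`. -/
def facetPolyhedron (β : Fin (n + 1) → ℝ) : Set (EuclideanSpace ℝ (Fin n)) :=
  {x | ∀ i, -β i ≤ (b.coord i).linear x}

lemma linear_coord_sum_smul_vertex (β : Fin (n + 1) → ℝ) (i : Fin (n + 1)) :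
    (b.coord i).linear (∑ k, β k • b k) = β i - (∑ k, β k) * b.coord i 0 := by
  rw [map_sum]
  simp only [map_smul, linear_coord_apply_vertex, smul_eq_mul, mul_sub, Finset.sum_sub_distrib,
    mul_ite, mul_one, mul_zero, Finset.sum_ite_eq, Finset.mem_univ, if_true, Finset.sum_mul]

lemma facetPolyhedron_eq_of_pos {β : Fin (n + 1) → ℝ} (hβ : 0 < ∑ i, β i) :
    facetPolyhedron b β =
      {-∑ k, β k • b k} + (∑ i, β i) • convexHull ℝ (Set.range b) := by
  ext x
  rw [Set.singleton_add, Set.image_add_left, Set.mem_preimage, mem_smul_simplex b hβ, neg_neg]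
  refine forall_congr' fun i => ?_
  rw [map_add, linear_coord_sum_smul_vertex]
  constructor <;> intro h <;> linarith

lemma facetPolyhedron_subset {β : Fin (n + 1) → ℝ} (hβ : 0 ≤ ∑ i, β i) :
    facetPolyhedron b β ⊆
      {-∑ k, β k • b k} + (∑ i, β i) • convexHull ℝ (Set.range b) := by
  rcases hβ.eq_or_lt with h0 | hpos
  · intro x hx
    rw [← h0, Set.zero_smul_set ((Set.range_nonempty b).convexHull), add_zero,
      Set.mem_singleton_iff, eq_neg_iff_add_eq_zero]
    have h1 : ∀ i, 0 ≤ (b.coord i).linear (x + ∑ k, β k • b k) := fun i => by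
      rw [map_add, linear_coord_sum_smul_vertex, ← h0]
      have := hx i
      linarith
    have h2 := (Finset.sum_eq_zero_iff_of_nonneg fun i _ => h1 i).1 (sum_linear_coord b _)
    refine b.ext_elem fun i => ?_
    rw [coord_eq_linear_add, h2 i (Finset.mem_univ i), zero_add]
  · exact (facetPolyhedron_eq_of_pos b hpos).le

lemma isClosed_facetPolyhedron (β : Fin (n + 1) → ℝ) : IsClosed (facetPolyhedron b β) := by
  simp only [facetPolyhedron, Set.ofPred_forall]
  exact isClosed_iInter fun i => isClosed_le continuous_const
    (LinearMap.continuous_of_finiteDimensional _)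

lemma volume_real_singleton_add_smul (y : EuclideanSpace ℝ (Fin n)) {s : ℝ} (hs : 0 ≤ s)
    (D : Set (EuclideanSpace ℝ (Fin n))) :
    (volume ({y} + s • D)).toReal = s ^ n * (volume D).toReal := by
  rw [Set.singleton_add, Set.image_add_left, measure_preimage_add, Measure.addHaar_smul,
    ENNReal.toReal_mul, finrank_euclideanSpace_fin, abs_of_nonneg (pow_nonneg hs n),
    ENNReal.toReal_ofReal (pow_nonneg hs n)]

lemma volume_real_facetPolyhedron {β : Fin (n + 1) → ℝ} (hβ : 0 < ∑ i, β i) :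
    (volume (facetPolyhedron b β)).toReal =
      (∑ i, β i) ^ n * (volume (convexHull ℝ (Set.range b))).toReal := by
  rw [facetPolyhedron_eq_of_pos b hβ, volume_real_singleton_add_smul _ hβ.le]

lemma isCompact_simplex : IsCompact (convexHull ℝ (Set.range b)) :=
  Set.Finite.isCompact_convexHull ℝ (Set.finite_range b)

lemma isConvexBody_simplex : IsConvexBody (convexHull ℝ (Set.range b)) :=
  ⟨convex_convexHull ℝ _, isCompact_simplex b, (Set.range_nonempty b).convexHull⟩

/-- `β` records the support numbers of `K` in the facet directions of the simplex. -/
def IsCircumscribed (β : Fin (n + 1) → ℝ) (K : Set (EuclideanSpace ℝ (Fin n))) : Prop :=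
  K ⊆ facetPolyhedron b β ∧ ∀ i, ∃ q ∈ K, (b.coord i).linear q = -β i

variable {b}

lemma exists_isCircumscribed {K : Set (EuclideanSpace ℝ (Fin n))} (hK : IsCompact K)
    (hne : K.Nonempty) : ∃ β, IsCircumscribed b β K := by
  choose q hq hmin using fun i => hK.exists_isMinOn hne
    (LinearMap.continuous_of_finiteDimensional (b.coord i).linear).continuousOn
  refine ⟨fun i => -(b.coord i).linear (q i), fun x hx i => ?_, fun i => ⟨q i, hq i, ?_⟩⟩
  · rw [neg_neg]
    exact hmin i hx
  · rw [neg_neg]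

lemma IsCircumscribed.smul {β : Fin (n + 1) → ℝ} {K : Set (EuclideanSpace ℝ (Fin n))}
    (h : IsCircumscribed b β K) {ε : ℝ} (hε : 0 < ε) :
    IsCircumscribed b (fun i => ε * β i) (ε • K) := by
  constructor
  · rintro _ ⟨x, hx, rfl⟩ i
    change _ ≤ (b.coord i).linear (ε • x)
    rw [map_smul, smul_eq_mul, ← mul_neg]
    exact mul_le_mul_of_nonneg_left (h.1 hx i) hε.le
  · intro i
    obtain ⟨q, hq, hqi⟩ := h.2 i
    exact ⟨ε • q, Set.smul_mem_smul_set hq, by rw [map_smul, hqi, smul_eq_mul, mul_neg]⟩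

lemma IsCircumscribed.sum_nonneg {β : Fin (n + 1) → ℝ} {K : Set (EuclideanSpace ℝ (Fin n))}
    (h : IsCircumscribed b β K) : 0 ≤ ∑ i, β i := by
  obtain ⟨q, hq, -⟩ := h.2 0
  have h1 := Finset.sum_le_sum fun i (_ : i ∈ Finset.univ) => h.1 hq i
  rw [sum_linear_coord, Finset.sum_neg_distrib] at h1
  linarith

lemma IsCircumscribed.facetPolyhedron_subset_add {β : Fin (n + 1) → ℝ}
    {K : Set (EuclideanSpace ℝ (Fin n))} (h : IsCircumscribed b β K) {s : ℝ} (hs : 0 < s)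
    (j : Fin (n + 1)) :
    facetPolyhedron b (fun i => β i + s * b.coord i 0 - if i = j then 0 else ∑ k, β k) ⊆
      K + s • convexHull ℝ (Set.range b) := by
  intro x hx
  obtain ⟨q, hq, hqj⟩ := h.2 j
  refine ⟨q, hq, x - q, (mem_smul_simplex b hs _).2 fun i => ?_, add_sub_cancel q x⟩
  have hxi := hx i
  rw [map_sub]
  by_cases hij : i = j
  · subst hij
    simp only [if_true] at hxi
    linarith
  · simp only [if_neg hij] at hxi
    have h1 : (b.coord i).linear q ≤ (∑ k, β k) - β i := by
      have h2 := sum_linear_coord b q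
      rw [← Finset.add_sum_erase _ _ (Finset.mem_univ i)] at h2 ⊢
      have h3 := Finset.sum_le_sum fun k (_ : k ∈ Finset.univ.erase i) => h.1 hq k
      rw [Finset.sum_neg_distrib] at h3
      linarith
    linarith

/-- A lower bound for the volume of `K + s • Δ`, exact up to second order as `s → ∞`. -/
lemma IsCircumscribed.le_volume_add {β : Fin (n + 1) → ℝ}
    {K : Set (EuclideanSpace ℝ (Fin n))} (h : IsCircumscribed b β K) (hK : IsCompact K) {s : ℝ}
    (hs : n * ∑ i, β i < s) :
    ((n + 1) * (s - (n - 1) * ∑ i, β i) ^ n - n * (s - n * ∑ i, β i) ^ n) *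
      (volume (convexHull ℝ (Set.range b))).toReal ≤
      (volume (K + s • convexHull ℝ (Set.range b))).toReal := by
  set t := ∑ i, β i with ht
  have ht0 : 0 ≤ t := h.sum_nonneg
  have hs0 : 0 < s := lt_of_le_of_lt (by positivity) hs
  have hc := b.sum_coord_apply_eq_one 0
  set P : Fin (n + 1) → Set (EuclideanSpace ℝ (Fin n)) := fun j =>
    facetPolyhedron b (fun i => β i + s * b.coord i 0 - if i = j then 0 else t) with hP
  set Q := facetPolyhedron b (fun i => β i + s * b.coord i 0 - t) with hQ
  have hQsum : ∑ i, (β i + s * b.coord i 0 - t) = s - n * t := by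
    rw [Finset.sum_sub_distrib, Finset.sum_add_distrib, ← Finset.mul_sum, hc]
    simp [← ht]
    ring
  have hPsum : ∀ j, ∑ i, (β i + s * b.coord i 0 - if i = j then 0 else t) =
      s - (n - 1) * t := fun j => by
    have h1 : ∑ i, (if i = j then 0 else t) = n * t := by
      rw [← Finset.add_sum_erase _ _ (Finset.mem_univ j), if_pos rfl, zero_add,
        Finset.sum_congr rfl fun i hi => if_neg (Finset.ne_of_mem_erase hi)]
      simp
    rw [Finset.sum_sub_distrib, Finset.sum_add_distrib, ← Finset.mul_sum, hc, h1, ← ht]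
    ring
  have hQP : ∀ j, Q ⊆ P j := fun j x hx i => by
    refine le_trans ?_ (hx i)
    dsimp only
    split_ifs <;> linarith
  have hPK : ∀ j, P j ⊆ K + s • convexHull ℝ (Set.range b) :=
    fun j => h.facetPolyhedron_subset_add hs0 j
  have hinter : ∀ j k, j ≠ k → P j ∩ P k ⊆ Q := by
    rintro j k hjk x ⟨hxj, hxk⟩ i
    by_cases hij : i = j
    · have := hxk i
      simpa only [if_neg (hij ▸ hjk : i ≠ k)] using this
    · have := hxj i
      simpa only [if_neg hij] using this
  have hcomp : IsCompact (K + s • convexHull ℝ (Set.range b)) :=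
    hK.add ((isCompact_simplex b).smul s)
  have hfin : volume (K + s • convexHull ℝ (Set.range b)) ≠ ⊤ := hcomp.measure_ne_top
  have hmQ : MeasurableSet Q := (isClosed_facetPolyhedron b _).measurableSet
  have hmP : ∀ j, MeasurableSet (P j) := fun j => (isClosed_facetPolyhedron b _).measurableSet
  have hfinP : ∀ j, volume (P j) ≠ ⊤ := fun j => measure_ne_top_of_subset (hPK j) hfin
  have hfinQ : volume Q ≠ ⊤ := measure_ne_top_of_subset (hQP 0) (hfinP 0)
  set v := (volume (convexHull ℝ (Set.range b))).toReal
  have hvQ : volume.real Q = (s - n * t) ^ n * v := by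
    have := volume_real_facetPolyhedron b (β := fun i => β i + s * b.coord i 0 - t)
      (by rw [hQsum]; linarith)
    rwa [hQsum] at this
  have hvP : ∀ j, volume.real (P j) = (s - (n - 1) * t) ^ n * v := fun j => by
    have := volume_real_facetPolyhedron b
      (β := fun i => β i + s * b.coord i 0 - if i = j then 0 else t) (by rw [hPsum]; linarith)
    rwa [hPsum] at this
  have hdisj : Pairwise (Function.onFun Disjoint fun j => P j \ Q) := fun j k hjk =>
    Set.disjoint_left.2 fun x hxj hxk => hxj.2 (hinter j k hjk ⟨hxj.1, hxk.1⟩)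
  have hU : volume.real (⋃ j, P j \ Q) = ∑ j, volume.real (P j \ Q) :=
    measureReal_iUnion_fintype hdisj (fun j => (hmP j).diff hmQ)
      fun j => measure_ne_top_of_subset Set.sdiff_subset (hfinP j)
  have hUQ : volume.real ((⋃ j, P j \ Q) ∪ Q) = volume.real (⋃ j, P j \ Q) + volume.real Q := by
    refine measureReal_union ?_ hmQ ?_ hfinQ
    · exact Set.disjoint_left.2 fun x hx hxQ => by
        obtain ⟨j, hj⟩ := Set.mem_iUnion.1 hx
        exact hj.2 hxQ
    · exact measure_ne_top_of_subset
        (Set.iUnion_subset fun j => Set.sdiff_subset.trans (hPK j)) hfin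
  have hle : volume.real ((⋃ j, P j \ Q) ∪ Q) ≤
      volume.real (K + s • convexHull ℝ (Set.range b)) := by
    refine measureReal_mono (Set.union_subset (Set.iUnion_subset fun j =>
      Set.sdiff_subset.trans (hPK j)) ((hQP 0).trans (hPK 0))) hfin
  have hdiff : ∀ j, volume.real (P j \ Q) =
      (s - (n - 1) * t) ^ n * v - (s - n * t) ^ n * v := fun j => by
    rw [measureReal_sdiff (hQP j) hmQ (hfinP j), hvP, hvQ]
  rw [hUQ, hU, Finset.sum_congr rfl fun j _ => hdiff j, hvQ] at hle
  refine le_trans (le_of_eq ?_) hle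
  simp
  ring

end Simplex

section Bezout

open Filter Topology Asymptotics

variable {n : ℕ}

lemma sum_singleton_add_smul {ι : Type*} {D : Set (EuclideanSpace ℝ (Fin n))}
    (hD : Convex ℝ D) (hne : D.Nonempty) (y : ι → EuclideanSpace ℝ (Fin n)) {s : ι → ℝ}
    (hs : ∀ i, 0 ≤ s i) (S : Finset ι) :
    ∑ i ∈ S, ({y i} + s i • D) = {∑ i ∈ S, y i} + (∑ i ∈ S, s i) • D := by
  classical
  induction S using Finset.induction_on with
  | empty => simp [Set.zero_smul_set hne, Set.singleton_zero]
  | insert a S ha ih =>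
    rw [Finset.sum_insert ha, Finset.sum_insert ha, Finset.sum_insert ha, ih,
      hD.add_smul (hs a) (Finset.sum_nonneg fun i _ => hs i), ← Set.singleton_add_singleton,
      add_add_add_comm]

lemma sum_const_eq_smul {ι : Type*} {D : Set (EuclideanSpace ℝ (Fin n))}
    (hD : Convex ℝ D) (hne : D.Nonempty) (S : Finset ι) :
    ∑ _i ∈ S, D = (S.card : ℝ) • D := by
  have := sum_singleton_add_smul hD hne (fun _ : ι => 0) (s := fun _ => 1)
    (fun _ => zero_le_one) S
  simpa only [one_smul, Finset.sum_const_zero, Set.singleton_zero, zero_add, Finset.sum_const,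
    nsmul_eq_mul, mul_one] using this

lemma mixedVol_singleton_add_smul {D : Set (EuclideanSpace ℝ (Fin n))}
    (hD : Convex ℝ D) (hne : D.Nonempty) (y : Fin n → EuclideanSpace ℝ (Fin n))
    {s : Fin n → ℝ} (hs : ∀ i, 0 ≤ s i) :
    mixedVol n (fun i => {y i} + s i • D) = (∏ i, s i) * (volume D).toReal := by
  have h : ∀ S : Finset (Fin n), (-1 : ℝ) ^ (n - S.card) *
      (volume (∑ i ∈ S, ({y i} + s i • D))).toReal =
      (-1 : ℝ) ^ (n - S.card) * (∑ i ∈ S, s i) ^ n * (volume D).toReal := fun S => by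
    rw [sum_singleton_add_smul hD hne y hs, volume_real_singleton_add_smul _
      (Finset.sum_nonneg fun i _ => hs i), mul_assoc]
  rw [mixedVol, Finset.sum_congr rfl fun S _ => h S, ← Finset.sum_mul,
    sum_neg_one_pow_mul_sum_pow, mul_assoc,
    inv_mul_cancel_left₀ (Nat.cast_ne_zero.2 n.factorial_ne_zero)]

lemma isLittleO_second_order (k t : ℝ) :
    (fun x : ℝ => (x * t + k) ^ n - ((n + 1) * (k - (n - 1) * (x * t)) ^ n -
      n * (k - n * (x * t)) ^ n)) =o[𝓝 0] fun x => x := by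
  have h1 : HasDerivAt (fun x : ℝ => x * t + k) t 0 := by
    simpa using ((hasDerivAt_id (0 : ℝ)).mul_const t).add_const k
  have h2 : ∀ a : ℝ, HasDerivAt (fun x : ℝ => k - a * (x * t)) (-(a * t)) 0 := fun a => by
    simpa using (((hasDerivAt_id (0 : ℝ)).mul_const t).const_mul a).const_sub k
  have h3 := (h1.pow n).sub ((((h2 (n - 1)).pow n).const_mul (n + 1 : ℝ)).sub
    (((h2 n).pow n).const_mul (n : ℝ)))
  have h4 := h3.isLittleO
  refine (h4.congr_left fun x => ?_).congr_right fun x => sub_zero x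
  simp
  ring

variable {b : AffineBasis (Fin (n + 1)) ℝ (EuclideanSpace ℝ (Fin n))}

lemma IsCircumscribed.subset_singleton_add_smul {β : Fin (n + 1) → ℝ}
    {K : Set (EuclideanSpace ℝ (Fin n))} (h : IsCircumscribed b β K) :
    K ⊆ {-∑ k, β k • b k} + (∑ i, β i) • convexHull ℝ (Set.range b) :=
  h.1.trans (facetPolyhedron_subset b h.sum_nonneg)

lemma IsCircumscribed.volume_add_le {β : Fin (n + 1) → ℝ}
    {K : Set (EuclideanSpace ℝ (Fin n))} (h : IsCircumscribed b β K) {s : ℝ} (hs : 0 ≤ s) :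
    (volume (K + s • convexHull ℝ (Set.range b))).toReal ≤
      (∑ i, β i + s) ^ n * (volume (convexHull ℝ (Set.range b))).toReal := by
  have hsum := h.sum_nonneg
  rw [← volume_real_singleton_add_smul (-∑ k, β k • b k) (add_nonneg hsum hs)]
  refine ENNReal.toReal_mono ?_ (measure_mono ?_)
  · exact (isCompact_singleton.add ((isCompact_simplex b).smul _)).measure_ne_top
  · rw [(convex_convexHull ℝ (Set.range b)).add_smul hsum hs, ← add_assoc]
    exact Set.add_subset_add_right h.subset_singleton_add_smul

lemma IsCircumscribed.isLittleO_volume_sub {β : Fin (n + 1) → ℝ}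
    {K : Set (EuclideanSpace ℝ (Fin n))} (h : IsCircumscribed b β K) (hK : IsCompact K)
    (hn : 2 ≤ n) (k : ℕ) :
    (fun ε : ℝ => (ε * ∑ i, β i + k) ^ n * (volume (convexHull ℝ (Set.range b))).toReal -
      (volume (ε • K + (k : ℝ) • convexHull ℝ (Set.range b))).toReal)
      =o[𝓝[>] 0] fun ε => ε := by
  set v := (volume (convexHull ℝ (Set.range b))).toReal with hv
  have hv0 : 0 ≤ v := ENNReal.toReal_nonneg
  have hle : ∀ ε : ℝ, 0 < ε → (volume (ε • K + (k : ℝ) • convexHull ℝ (Set.range b))).toReal ≤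
      (ε * ∑ i, β i + k) ^ n * v := fun ε hε => by
    have := (h.smul hε).volume_add_le (Nat.cast_nonneg k)
    rwa [← Finset.mul_sum] at this
  rcases Nat.eq_zero_or_pos k with rfl | hk
  · have h1 : (fun ε : ℝ => (∑ i, β i) ^ n * v * ε ^ n) =o[𝓝[>] 0] fun ε => ε := by
      have := (isLittleO_pow_pow (𝕜 := ℝ) (show 1 < n by omega)).const_mul_left ((∑ i, β i) ^ n * v)
      simp only [pow_one] at this
      exact this.mono nhdsWithin_le_nhds
    refine IsBigO.trans_isLittleO (IsBigO.of_bound 1 ?_) h1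
    filter_upwards [self_mem_nhdsWithin] with ε hε
    rw [one_mul, Real.norm_of_nonneg (sub_nonneg.2 (hle ε hε))]
    refine le_trans ?_ (le_abs_self _)
    have h0 : 0 ≤ (volume (ε • K + ((0 : ℕ) : ℝ) • convexHull ℝ (Set.range b))).toReal :=
      ENNReal.toReal_nonneg
    have h2 : (ε * ∑ i, β i + ((0 : ℕ) : ℝ)) ^ n * v = (∑ i, β i) ^ n * v * ε ^ n := by
      rw [Nat.cast_zero, add_zero, mul_pow]
      ring
    linarith
  · have h1 := ((isLittleO_second_order (n := n) (k : ℝ) (∑ i, β i)).const_mul_left v).mono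
      (nhdsWithin_le_nhds (s := Set.Ioi 0))
    refine IsBigO.trans_isLittleO (IsBigO.of_bound 1 ?_) h1
    have hlim : ∀ᶠ ε : ℝ in 𝓝[>] 0, n * (ε * ∑ i, β i) < k := by
      refine Filter.Eventually.filter_mono nhdsWithin_le_nhds ?_
      have hc : Continuous fun ε : ℝ => n * (ε * ∑ i, β i) := by fun_prop
      refine hc.continuousAt.eventually_lt continuousAt_const ?_
      simpa using hk
    filter_upwards [self_mem_nhdsWithin, hlim] with ε hε hεk
    rw [one_mul, Real.norm_of_nonneg (sub_nonneg.2 (hle ε hε))]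
    refine le_trans ?_ (le_abs_self _)
    have h2 := (h.smul hε).le_volume_add (hK.smul ε) (s := k) (by rwa [← Finset.mul_sum])
    rw [← Finset.mul_sum] at h2
    linarith

lemma IsCircumscribed.mixedVol_eq {β : Fin (n + 1) → ℝ}
    {K : Set (EuclideanSpace ℝ (Fin n))} (h : IsCircumscribed b β K) (hK : IsConvexBody K)
    (hn : 2 ≤ n) (i₀ : Fin n) :
    mixedVol n (fun j => if j = i₀ then K else convexHull ℝ (Set.range b)) =
      (∑ i, β i) * (volume (convexHull ℝ (Set.range b))).toReal := by
  set Δ := convexHull ℝ (Set.range b) with hΔ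
  have hb : IsConvexBody Δ := isConvexBody_simplex b
  set t := ∑ i, β i with ht
  have ht0 : 0 ≤ t := h.sum_nonneg
  set v := (volume Δ).toReal with hv
  set V := mixedVol n (fun j => if j = i₀ then K else Δ) with hV
  have hprod : ∀ a : ℝ, ∏ j : Fin n, (if j = i₀ then a else 1) = a := fun a => by
    rw [Finset.prod_ite_eq' Finset.univ i₀ fun _ => a, if_pos (Finset.mem_univ _)]
  have hsmall : ∀ ε : ℝ, 0 < ε → mixedVol n (fun j => if j = i₀ then ε • K else Δ) = ε * V := by
    intro ε hε
    have h1 := mixedVol_smul (K := fun j : Fin n => if j = i₀ then K else Δ)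
      (fun j => by split_ifs <;> assumption) (c := fun j => if j = i₀ then ε else 1)
      (fun j => by split_ifs <;> positivity)
    rw [hprod] at h1
    rw [← h1]
    congr 1
    ext1 j
    split_ifs
    · rfl
    · rw [one_smul]
  set B : ℝ → Fin n → Set (EuclideanSpace ℝ (Fin n)) := fun ε j =>
    {0} + (if j = i₀ then ε * t else 1) • Δ with hB
  have hs : ∀ ε : ℝ, 0 < ε → ∀ j : Fin n, 0 ≤ if j = i₀ then ε * t else 1 := fun ε hε j => by
    split_ifs <;> positivity
  have hbig : ∀ ε : ℝ, 0 < ε → mixedVol n (B ε) = ε * (t * v) := by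
    intro ε hε
    rw [hB, mixedVol_singleton_add_smul hb.1 hb.2.2 (fun _ => 0) (hs ε hε), hprod, mul_assoc]
  have hterm : ∀ S : Finset (Fin n), (fun ε : ℝ => (volume (∑ j ∈ S, B ε j)).toReal -
      (volume (∑ j ∈ S, if j = i₀ then ε • K else Δ)).toReal) =o[𝓝[>] 0] fun ε => ε := by
    intro S
    by_cases hi : i₀ ∈ S
    · refine (h.isLittleO_volume_sub hK.2.1 hn (S.erase i₀).card).congr' ?_ EventuallyEq.rfl
      filter_upwards [self_mem_nhdsWithin] with ε (hε : 0 < ε)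
      have h1 : ∑ j ∈ S, (if j = i₀ then ε * t else 1) = ε * t + (S.erase i₀).card := by
        rw [← Finset.add_sum_erase _ _ hi, if_pos rfl,
          Finset.sum_congr rfl fun j hj => if_neg (Finset.ne_of_mem_erase hj)]
        simp
      have h2 : ∑ j ∈ S, (if j = i₀ then ε • K else Δ) =
          ε • K + ((S.erase i₀).card : ℝ) • Δ := by
        rw [← Finset.add_sum_erase _ _ hi, if_pos rfl,
          Finset.sum_congr rfl fun j hj => if_neg (Finset.ne_of_mem_erase hj),
          sum_const_eq_smul hb.1 hb.2.2]
      rw [h2, hB, sum_singleton_add_smul hb.1 hb.2.2 (fun _ => 0) (hs ε hε), h1,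
        volume_real_singleton_add_smul _ (by positivity)]
    · refine (isLittleO_zero _ _).congr_left fun ε => ?_
      rw [eq_comm, sub_eq_zero]
      congr 2
      refine Finset.sum_congr rfl fun j hj => ?_
      have hj : j ≠ i₀ := fun h => hi (h ▸ hj)
      simp only [hB, if_neg hj, one_smul, Set.singleton_zero, zero_add]
  have hsum : (fun ε : ℝ => ((n.factorial : ℝ))⁻¹ * ∑ S : Finset (Fin n),
      (-1 : ℝ) ^ (n - S.card) * ((volume (∑ j ∈ S, B ε j)).toReal -
      (volume (∑ j ∈ S, if j = i₀ then ε • K else Δ)).toReal)) =o[𝓝[>] 0] fun ε => ε :=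
    (IsLittleO.fun_sum fun S _ => (hterm S).const_mul_left _).const_mul_left _
  have hd : (fun ε : ℝ => (t * v - V) * ε) =o[𝓝[>] 0] fun ε => ε := by
    refine hsum.congr' ?_ EventuallyEq.rfl
    filter_upwards [self_mem_nhdsWithin] with ε hε
    have h1 := hbig ε hε
    have h2 := hsmall ε hε
    rw [mixedVol] at h1 h2
    simp only [mul_sub, Finset.sum_sub_distrib]
    rw [h1, h2]
    ring
  by_contra hne
  have h0 : t * v - V ≠ 0 := fun h => hne (by linarith)
  have h1 := (isLittleO_const_mul_left_iff h0).1 hd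
  refine (isLittleO_irrefl (Eventually.frequently ?_)) h1
  filter_upwards [self_mem_nhdsWithin] with ε hε using ne_of_gt hε

end Bezout

/-- The Bezout inequality for mixed volumes holds for any `n`-dimensional simplex `Δ` in
`ℝⁿ` and any convex bodies `K₁,…,K_r`, `2 ≤ r ≤ n`:
`V(K₁,…,K_r,Δ[n-r]) V_n(Δ)^{r-1} ≤ ∏ᵢ V(Kᵢ,Δ[n-1])`. -/
theorem bezout_inequality_for_simplex (n r : ℕ) (hr2 : 2 ≤ r) (hrn : r ≤ n)
    (Δ : Set (EuclideanSpace ℝ (Fin n)))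
    (hΔ : ∃ p : Fin (n + 1) → EuclideanSpace ℝ (Fin n),
      AffineIndependent ℝ p ∧ Δ = convexHull ℝ (Set.range p)) :
    ∀ K : Fin r → Set (EuclideanSpace ℝ (Fin n)), (∀ i, IsConvexBody (K i)) →
      mixedVol n (fun j : Fin n => if h : (j : ℕ) < r then K ⟨(j : ℕ), h⟩ else Δ) *
          (mixedVol n (fun _ => Δ)) ^ (r - 1) ≤
        ∏ i : Fin r, mixedVol n (fun j : Fin n => if (j : ℕ) = 0 then K i else Δ) := by
  obtain ⟨p, hp, rfl⟩ := hΔ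
  intro K hK
  obtain ⟨b, rfl⟩ : ∃ b : AffineBasis (Fin (n + 1)) ℝ (EuclideanSpace ℝ (Fin n)), ⇑b = p :=
    ⟨⟨p, hp, hp.affineSpan_eq_top_iff_card_eq_finrank_add_one.2 (by simp)⟩, rfl⟩
  choose β hβ using fun i => exists_isCircumscribed (b := b) (hK i).2.1 (hK i).2.2
  have hb := isConvexBody_simplex b
  have hn : 2 ≤ n := hr2.trans hrn
  set Δ := convexHull ℝ (Set.range b) with hΔ
  set v := (volume Δ).toReal with hv
  have hv0 : 0 ≤ v := ENNReal.toReal_nonneg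
  have hΔv : mixedVol n (fun _ => Δ) = v := by
    have := mixedVol_singleton_add_smul hb.1 hb.2.2 (fun _ : Fin n => 0) (s := fun _ => 1)
      fun _ => zero_le_one
    simpa only [one_smul, Set.singleton_zero, zero_add, Finset.prod_const_one, one_mul] using this
  have hR : ∀ i, mixedVol n (fun j : Fin n => if (j : ℕ) = 0 then K i else Δ) =
      (∑ k, β i k) * v := fun i => by
    rw [← (hβ i).mixedVol_eq (hK i) hn ⟨0, by omega⟩]
    simp only [Fin.ext_iff]
    rfl
  have hL : mixedVol n (fun j : Fin n => if h : (j : ℕ) < r then K ⟨(j : ℕ), h⟩ else Δ) ≤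
      (∏ i, ∑ k, β i k) * v := by
    set s : Fin n → ℝ := fun j => if h : (j : ℕ) < r then ∑ k, β ⟨j, h⟩ k else 1 with hs
    set y : Fin n → EuclideanSpace ℝ (Fin n) := fun j =>
      if h : (j : ℕ) < r then -∑ k, β ⟨j, h⟩ k • b k else 0 with hy
    have hs0 : ∀ j, 0 ≤ s j := fun j => by
      simp only [hs]
      split_ifs
      exacts [(hβ _).sum_nonneg, zero_le_one]
    have hprod : ∏ j, s j = ∏ i, ∑ k, β i k := by
      obtain ⟨m, rfl⟩ := Nat.exists_eq_add_of_le hrn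
      rw [Fin.prod_univ_add]
      simp [hs]
    rw [← hprod, ← mixedVol_singleton_add_smul hb.1 hb.2.2 y hs0]
    refine mixedVol_mono (fun j => ?_) (fun j => ⟨?_, ?_, ?_⟩) fun j => ?_
    · split_ifs
      exacts [hK _, hb]
    · exact (convex_singleton _).add (hb.1.smul _)
    · exact isCompact_singleton.add (hb.2.1.smul _)
    · exact (Set.singleton_nonempty _).add hb.2.2.smul_set
    · simp only [hs, hy]
      split_ifs
      · exact (hβ _).subset_singleton_add_smul
      · rw [one_smul, Set.singleton_zero, zero_add]
  rw [hΔv, Finset.prod_congr rfl fun i _ => hR i, Finset.prod_mul_distrib]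
  refine (mul_le_mul_of_nonneg_right hL (pow_nonneg hv0 _)).trans_eq ?_
  rw [mul_assoc, ← pow_succ', Nat.sub_add_cancel (by omega)]
  simp
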